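/- Let m ≥ 2 be an integer and for each integer a with 0 ≤ a ≤ m−2 define the theta series Φ_m^{(a)}(τ) = Σ_{n∈ℤ} n χ_{2m}^{(a)}(n) e^{π i n² τ/(2m)} for τ in the upper half-plane. Then for every τ in the upper half-plane and every integer a with 1 ≤ a ≤ m−1, Φ_m^{(m−1−a)}(τ) = (i/τ)^{3/2} Σ_{b=1}^{m−1} √(2/m) sin(a b π / m) · Φ_m^{(m−1−b)}(−1/τ), where (i/τ)^{3/2} is taken with the principal branch. -/

import Mathlib

open scoped Real BigOperators
open Complex (I)

/-- The odd periodic function `χ_{2m}^{(a)} : ℤ → ℂ` with period `2m`, taking the value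
`+1` at `n ≡ m−1−a (mod 2m)`, `−1` at `n ≡ m+1+a (mod 2m)`, and `0` otherwise. -/
def chi (m a : ℕ) (n : ℤ) : ℂ :=
  if (n : ZMod (2 * m)) = ((m - 1 - a : ℕ) : ZMod (2 * m)) then 1
  else if (n : ZMod (2 * m)) = ((m + 1 + a : ℕ) : ZMod (2 * m)) then -1
  else 0

/-- The weight-`3/2` theta series
`Φ_m^{(a)}(τ) = Σ_{n∈ℤ} n χ_{2m}^{(a)}(n) e^{πin²τ/(2m)}` (for `Im τ > 0`). -/
noncomputable def Phi (m a : ℕ) (τ : ℂ) : ℂ :=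
  ∑' n : ℤ, (n : ℂ) * chi m a n * Complex.exp ((π : ℂ) * I * (n : ℂ) ^ 2 * τ / (2 * m))

lemma chi_eq_sub {m b : ℕ} (hb1 : 1 ≤ b) (hb2 : b ≤ m - 1) (n : ℤ) :
    chi m (m - 1 - b) n =
      (if ((2 * m : ℕ) : ℤ) ∣ n - b then 1 else 0) -
        (if ((2 * m : ℕ) : ℤ) ∣ n + b then 1 else 0) := by
  have h1 : (n : ZMod (2 * m)) = ((m - 1 - (m - 1 - b) : ℕ) : ZMod (2 * m)) ↔
      ((2 * m : ℕ) : ℤ) ∣ n - b := by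
    rw [show m - 1 - (m - 1 - b) = b by omega, ← Int.cast_natCast b, eq_comm,
      ZMod.intCast_eq_intCast_iff_dvd_sub]
  have h2 : (n : ZMod (2 * m)) = ((m + 1 + (m - 1 - b) : ℕ) : ZMod (2 * m)) ↔
      ((2 * m : ℕ) : ℤ) ∣ n + b := by
    rw [← Int.cast_natCast (m + 1 + (m - 1 - b)), eq_comm, ZMod.intCast_eq_intCast_iff_dvd_sub,
      show n - ((m + 1 + (m - 1 - b) : ℕ) : ℤ) = n + b - ((2 * m : ℕ) : ℤ) by omega,
      dvd_sub_self_right]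
  have h3 : ((2 * m : ℕ) : ℤ) ∣ n - b → ¬ ((2 * m : ℕ) : ℤ) ∣ n + b := by
    intro h h'
    have h4 : ((2 * m : ℕ) : ℤ) ∣ 2 * b := by
      simpa [two_mul] using dvd_sub h' h
    have := Int.le_of_dvd (by omega) h4
    omega
  rw [chi]
  simp only [h1, h2]
  split_ifs with h h' <;> first | exact absurd ‹_› (h3 ‹_›) | simp

lemma sum_mul_chi {m : ℕ} (hm : 2 ≤ m) {g : ℤ → ℂ} (hodd : ∀ n, g (-n) = -g n)
    (hper : Function.Periodic g (2 * m : ℕ)) (n : ℤ) :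
    ∑ b ∈ Finset.Icc 1 (m - 1), g b * chi m (m - 1 - b) n = g n := by
  have hdvd : ∀ k l : ℤ, ((2 * m : ℕ) : ℤ) ∣ k - l → g k = g l := by
    rintro k l ⟨c, hc⟩
    rw [show k = l + c * ((2 * m : ℕ) : ℤ) by linarith]
    exact hper.int_mul c l
  have hzero : ∀ k : ℤ, ((2 * m : ℕ) : ℤ) ∣ 2 * k → g k = 0 := by
    intro k hk
    have h := hdvd k (-k) (by rwa [sub_neg_eq_add, ← two_mul])
    rw [hodd] at h
    exact self_eq_neg.mp h
  have hsum : ∀ b ∈ Finset.Icc 1 (m - 1), g b * chi m (m - 1 - b) n =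
      if ((2 * m : ℕ) : ℤ) ∣ n - b ∨ ((2 * m : ℕ) : ℤ) ∣ n + b then g n else 0 := by
    intro b hb
    rw [Finset.mem_Icc] at hb
    rw [chi_eq_sub hb.1 hb.2]
    by_cases h1 : ((2 * m : ℕ) : ℤ) ∣ n - b <;> by_cases h2 : ((2 * m : ℕ) : ℤ) ∣ n + b
    · have h3 : ((2 * m : ℕ) : ℤ) ∣ 2 * n := by simpa [two_mul] using dvd_add h1 h2
      rw [if_pos h1, if_pos h2, if_pos (Or.inl h1), hzero n h3, sub_self, mul_zero]
    · rw [if_pos h1, if_neg h2, if_pos (Or.inl h1), hdvd _ _ h1, sub_zero, mul_one]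
    · have h3 := hdvd n (-b) (by rwa [sub_neg_eq_add])
      rw [hodd] at h3
      rw [if_neg h1, if_pos h2, if_pos (Or.inr h2), h3, zero_sub, mul_neg_one]
    · rw [if_neg h1, if_neg h2, if_neg (not_or.mpr ⟨h1, h2⟩), sub_zero, mul_zero]
  rw [Finset.sum_congr rfl hsum]
  have hr0 := Int.emod_nonneg n (b := ((2 * m : ℕ) : ℤ)) (by omega)
  have hr1 := Int.emod_lt_of_pos n (b := ((2 * m : ℕ) : ℤ)) (by omega)
  have hr : ((2 * m : ℕ) : ℤ) ∣ n - n % ((2 * m : ℕ) : ℤ) := Int.dvd_self_sub_emod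
  obtain ⟨r, hr'⟩ := Int.eq_ofNat_of_zero_le hr0
  rw [hr'] at hr hr1 hr0
  have hminus : ∀ b : ℕ, ((2 * m : ℕ) : ℤ) ∣ n - b ↔ ((2 * m : ℕ) : ℤ) ∣ (r : ℤ) - b := by
    intro b
    rw [← dvd_add_right hr (c := (r : ℤ) - b)]
    ring_nf
  have hplus : ∀ b : ℕ, ((2 * m : ℕ) : ℤ) ∣ n + b ↔ ((2 * m : ℕ) : ℤ) ∣ (r : ℤ) + b := by
    intro b
    rw [← dvd_add_right hr (c := (r : ℤ) + b)]
    ring_nf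
  have hiff : ∀ b ∈ Finset.Icc 1 (m - 1),
      ((((2 * m : ℕ) : ℤ) ∣ n - b ∨ ((2 * m : ℕ) : ℤ) ∣ n + b) ↔ b = r ∨ b = 2 * m - r) := by
    intro b hb
    rw [Finset.mem_Icc] at hb
    have hb' : (b : ℤ) < m := by omega
    rw [hminus, hplus]
    constructor
    · rintro (⟨c, hc⟩ | ⟨c, hc⟩)
      · left
        have : c = 0 := by
          have h1 : c < 1 := by push_cast at *; nlinarith
          have h2 : -1 < c := by push_cast at *; nlinarith
          omega
        subst this
        omega
      · right
        have : c = 1 := by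
          have h1 : c < 2 := by push_cast at *; nlinarith
          have h2 : 0 < c := by push_cast at *; nlinarith
          omega
        subst this
        omega
    · rintro (h | h)
      · left; simp [h]
      · right; rw [h]; exact ⟨1, by omega⟩
  by_cases hcase : r = 0 ∨ r = m
  · have : g n = 0 := by
      rw [hdvd n r hr]
      apply hzero
      rcases hcase with h | h
      · simp [h]
      · simp [h]
    simp [this]
  · push Not at hcase
    rw [Finset.sum_eq_single (if r < m then r else 2 * m - r)]
    · rw [if_pos]
      rw [hiff _ (by rw [Finset.mem_Icc]; split_ifs <;> omega)]
      split_ifs <;> simp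
    · intro b hb hne
      rw [if_neg]
      rw [hiff b hb]
      rw [Finset.mem_Icc] at hb
      split_ifs at hne <;> omega
    · intro h
      exfalso
      apply h
      rw [Finset.mem_Icc]
      split_ifs <;> omega

lemma hasSum_jacobiTheta₂'' (z : ℂ) {τ : ℂ} (hτ : 0 < τ.im) :
    HasSum (fun n : ℤ ↦ (n + z) * Complex.exp (π * I * (n + z) ^ 2 * τ))
      (HurwitzZeta.jacobiTheta₂'' z τ) := by
  have h1 := hasSum_jacobiTheta₂_term (z * τ) hτ
  have h2 := hasSum_jacobiTheta₂'_term (z * τ) hτ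
  refine (((h2.div_const (2 * π * I)).add (h1.mul_left z)).mul_left
    (Complex.exp (π * I * z ^ 2 * τ))).congr_fun (fun n ↦ ?_)
  rw [jacobiTheta₂'_term, mul_assoc (2 * π * I), mul_div_cancel_left₀ _ Complex.two_pi_I_ne_zero,
    ← add_mul, mul_left_comm, jacobiTheta₂_term, ← Complex.exp_add]
  ring_nf

lemma hasSum_residueClass {m : ℕ} (hm : 0 < m) (r : ℤ) {τ : ℂ} (hτ : 0 < τ.im) :
    HasSum (fun n : ℤ ↦ if ((2 * m : ℕ) : ℤ) ∣ n - r then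
        (n : ℂ) * Complex.exp ((π : ℂ) * I * (n : ℂ) ^ 2 * τ / (2 * m)) else 0)
      (2 * m * HurwitzZeta.jacobiTheta₂'' (r / (2 * m)) (2 * m * τ)) := by
  have hm' : (m : ℂ) ≠ 0 := by exact_mod_cast hm.ne'
  have him : 0 < (2 * m * τ : ℂ).im := by
    rw [show (2 * m * τ : ℂ) = ((2 * m : ℝ) : ℂ) * τ by push_cast; rfl, Complex.im_ofReal_mul]
    positivity
  have hinj : Function.Injective (fun k : ℤ ↦ ((2 * m : ℕ) : ℤ) * k + r) := by
    intro k l h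
    simpa [hm.ne'] using h
  rw [← hinj.hasSum_iff]
  · refine ((hasSum_jacobiTheta₂'' (r / (2 * m)) him).mul_left (2 * m : ℂ)).congr_fun
      (fun n ↦ ?_)
    simp only [Function.comp_apply, add_sub_cancel_right, dvd_mul_right, if_true]
    push_cast
    rw [← mul_assoc]
    congr 1
    · field_simp
    · congr 1
      field_simp
  · intro n hn
    rw [if_neg]
    rintro ⟨c, hc⟩
    exact hn ⟨c, by simp only; omega⟩

lemma hasSum_Phi {m b : ℕ} (hb1 : 1 ≤ b) (hb2 : b ≤ m - 1) {τ : ℂ} (hτ : 0 < τ.im) :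
    HasSum (fun n : ℤ ↦ (n : ℂ) * chi m (m - 1 - b) n *
        Complex.exp ((π : ℂ) * I * (n : ℂ) ^ 2 * τ / (2 * m)))
      (4 * m * HurwitzZeta.jacobiTheta₂'' (b / (2 * m)) (2 * m * τ)) := by
  have h := (hasSum_residueClass (by omega : 0 < m) b hτ).sub
    (hasSum_residueClass (by omega : 0 < m) (-b) hτ)
  push_cast at h
  rw [neg_div, HurwitzZeta.jacobiTheta₂''_neg_left] at h
  convert! h using 1
  · funext n
    rw [chi_eq_sub hb1 hb2]
    push_cast
    simp only [sub_neg_eq_add]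
    split_ifs <;> ring
  · ring

lemma hasSum_sin_jacobiTheta₂' (z : ℂ) {τ : ℂ} (hτ : 0 < τ.im) :
    HasSum (fun n : ℤ ↦ (n : ℂ) * Complex.sin (2 * π * n * z) * Complex.exp (π * I * n ^ 2 * τ))
      (jacobiTheta₂' z τ / (-2 * π)) := by
  have h := ((hasSum_jacobiTheta₂'_term z hτ).sub
    (hasSum_jacobiTheta₂'_term (-z) hτ)).div_const (-4 * π : ℂ)
  have hpi : (π : ℂ) ≠ 0 := by exact_mod_cast Real.pi_ne_zero
  rw [jacobiTheta₂'_neg_left] at h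
  convert! h using 1
  · funext n
    simp only [jacobiTheta₂'_term, jacobiTheta₂_term, Complex.exp_add, Complex.sin]
    rw [show -(2 * π * n * z) * I = 2 * π * I * n * -z by ring,
      show 2 * π * n * z * I = 2 * π * I * n * z by ring]
    field_simp
    ring
  · field_simp
    ring

lemma jacobiTheta₂''_eq (z : ℂ) {τ : ℂ} (hτ : τ ≠ 0) :
    HurwitzZeta.jacobiTheta₂'' z τ =
      (I / τ) ^ ((3 : ℂ) / 2) * (jacobiTheta₂' z (-1 / τ) / (-2 * π)) := by
  have hpi : (π : ℂ) ≠ 0 := by exact_mod_cast Real.pi_ne_zero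
  have h := HurwitzZeta.jacobiTheta₂'_functional_equation' z (-1 / τ)
  rw [show -1 / (-1 / τ) = τ by field_simp, show -I * (-1 / τ) = I / τ by ring] at h
  have hne : (I / τ) ^ ((3 : ℂ) / 2) ≠ 0 := by
    rw [Complex.cpow_ne_zero_iff]
    exact Or.inl (div_ne_zero Complex.I_ne_zero hτ)
  rw [h]
  field_simp

lemma four_mul_cpow_eq {m : ℕ} (hm : 0 < m) (w : ℂ) :
    4 * m * (w / (2 * m)) ^ ((3 : ℂ) / 2) = Real.sqrt (2 / m) * w ^ ((3 : ℂ) / 2) := by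
  have hm' : (0 : ℝ) < m := by exact_mod_cast hm
  have hx : (0 : ℝ) < 1 / (2 * m) := by positivity
  rcases eq_or_ne w 0 with rfl | hw
  · rw [zero_div, Complex.zero_cpow (by norm_num), mul_zero, mul_zero]
  have hreal : 4 * m * (1 / (2 * m) : ℝ) ^ (3 / 2 : ℝ) = Real.sqrt (2 / m) := by
    rw [show (3 / 2 : ℝ) = 1 + 1 / 2 by norm_num, Real.rpow_add hx, Real.rpow_one,
      ← Real.sqrt_eq_rpow, show (2 / m : ℝ) = 2 ^ 2 * (1 / (2 * m)) by field_simp,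
      Real.sqrt_mul (by norm_num), Real.sqrt_sq (by norm_num)]
    field_simp
    norm_num
  have hxC : ((1 / (2 * m) : ℝ) : ℂ) ≠ 0 := by exact_mod_cast hx.ne'
  rw [show w / (2 * m) = ((1 / (2 * m) : ℝ) : ℂ) * w by push_cast; ring, ← hreal,
    Complex.cpow_def_of_ne_zero (mul_ne_zero hxC hw), Complex.log_ofReal_mul hx hw, add_mul,
    Complex.exp_add, Complex.cpow_def_of_ne_zero hw, Complex.ofReal_mul, Complex.ofReal_cpow hx.le,
    Complex.cpow_def_of_ne_zero hxC, Complex.ofReal_log hx.le]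
  push_cast
  ring

/-- for `m ≥ 2`, `τ` in the upper half-plane and `1 ≤ a ≤ m−1`,
`Φ_m^{(m−1−a)}(τ) = (i/τ)^{3/2} Σ_{b=1}^{m−1} √(2/m) sin(abπ/m) Φ_m^{(m−1−b)}(−1/τ)`,
with the principal branch of `(i/τ)^{3/2}`. -/
theorem stmt13 (m : ℕ) (hm : 2 ≤ m) (τ : ℂ) (hτ : 0 < τ.im)
    (a : ℕ) (ha1 : 1 ≤ a) (ha2 : a ≤ m - 1) :
    Phi m (m - 1 - a) τ =
      (I / τ) ^ ((3 : ℂ) / 2) *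
        ∑ b ∈ Finset.Icc 1 (m - 1),
          (Real.sqrt (2 / m) : ℂ) * (Real.sin (a * b * π / m) : ℂ) *
            Phi m (m - 1 - b) (-1 / τ) := by
  have hm0 : 0 < m := by omega
  have hmC : (m : ℂ) ≠ 0 := by exact_mod_cast hm0.ne'
  have hτ0 : τ ≠ 0 := by
    rintro rfl
    simp at hτ
  have hS : 0 < (-1 / τ).im := by
    rw [neg_div, Complex.neg_im, one_div, Complex.inv_im, neg_div, neg_neg]
    exact div_pos hτ (Complex.normSq_pos.mpr hτ0)
  have hS' : 0 < (-1 / (2 * m * τ)).im := by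
    rw [show (-1 / (2 * m * τ) : ℂ) = ((1 / (2 * m) : ℝ) : ℂ) * (-1 / τ) by
      push_cast; field_simp, Complex.im_ofReal_mul]
    positivity
  let g : ℤ → ℂ := fun n ↦ Complex.sin (a * n * π / m)
  have hodd : ∀ n, g (-n) = -g n := by
    intro n
    simp only [g]
    rw [← Complex.sin_neg]
    push_cast
    ring_nf
  have hper : Function.Periodic g (2 * m : ℕ) := by
    intro n
    simp only [g]
    rw [← Complex.sin_add_nat_mul_two_pi (a * n * π / m) a]
    congr 1
    push_cast
    field_simp
  have hsum : ∑ b ∈ Finset.Icc 1 (m - 1), g b * Phi m (m - 1 - b) (-1 / τ) =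
      jacobiTheta₂' (a / (2 * m)) (-1 / (2 * m * τ)) / (-2 * π) := by
    have h1 := hasSum_sum (s := Finset.Icc 1 (m - 1)) (fun b hb ↦
      (hasSum_Phi (Finset.mem_Icc.mp hb).1 (Finset.mem_Icc.mp hb).2 hS).mul_left (g b))
    have h2 := hasSum_sin_jacobiTheta₂' (a / (2 * m)) hS'
    rw [← h2.tsum_eq]
    trans ∑' n : ℤ, ∑ b ∈ Finset.Icc 1 (m - 1), g b * ((n : ℂ) * chi m (m - 1 - b) n *
        Complex.exp ((π : ℂ) * I * (n : ℂ) ^ 2 * (-1 / τ) / (2 * m)))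
    · rw [h1.tsum_eq]
      refine Finset.sum_congr rfl fun b hb ↦ ?_
      rw [Phi, (hasSum_Phi (Finset.mem_Icc.mp hb).1 (Finset.mem_Icc.mp hb).2 hS).tsum_eq]
    · refine tsum_congr fun n ↦ ?_
      rw [show (2 * π * n * (a / (2 * m)) : ℂ) = a * n * π / m by field_simp,
        show π * I * n ^ 2 * (-1 / (2 * m * τ)) = π * I * n ^ 2 * (-1 / τ) / (2 * m) by
          field_simp]
      change _ = (n : ℂ) * g n * _
      rw [← sum_mul_chi hm hodd hper n, Finset.mul_sum, Finset.sum_mul]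
      exact Finset.sum_congr rfl fun b _ ↦ by ring
  calc Phi m (m - 1 - a) τ
      = 4 * m * HurwitzZeta.jacobiTheta₂'' (a / (2 * m)) (2 * m * τ) :=
        (hasSum_Phi ha1 ha2 hτ).tsum_eq
    _ = Real.sqrt (2 / m) * (I / τ) ^ ((3 : ℂ) / 2) *
          ∑ b ∈ Finset.Icc 1 (m - 1), g b * Phi m (m - 1 - b) (-1 / τ) := by
        rw [jacobiTheta₂''_eq _ (by simp [hτ0, hmC]), hsum, ← mul_assoc,
          show I / (2 * m * τ) = I / τ / (2 * m) by field_simp, four_mul_cpow_eq hm0]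
    _ = _ := by
        rw [mul_comm (Real.sqrt (2 / m) : ℂ), mul_assoc, Finset.mul_sum]
        congr 1
        refine Finset.sum_congr rfl fun b _ ↦ ?_
        simp only [g]
        push_cast
        ring
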